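/- arXiv:1910.10680 — 4 statements merged into one kernel-verified Lean document; each statement's English description precedes it below -/
import Mathlib

section
/- For any two deterministic one-clock timed automata A and B, if their recognized reset-logical-timed languages coincide, i.e. L_r(A) = L_r(B), then their recognized (delay-)timed languages coincide, i.e. 𝓛(A) = 𝓛(B). (Theorem 1 of the paper.) -/
open scoped Classical NNReal

/-- Clock constraints over a single clock `c`:
`φ ::= ⊤ | c = m | c < m | c > m | c ≤ m | c ≥ m | φ ∧ φ` with `m ∈ ℕ`. -/
inductive ClockConstraint : Type where
  | top : ClockConstraint
  | eq (m : ℕ) : ClockConstraint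
  | lt (m : ℕ) : ClockConstraint
  | gt (m : ℕ) : ClockConstraint
  | le (m : ℕ) : ClockConstraint
  | ge (m : ℕ) : ClockConstraint
  | conj (φ₁ φ₂ : ClockConstraint) : ClockConstraint

/-- Satisfaction of a clock constraint by a clock value `μ ∈ ℝ≥0`. -/
def ClockConstraint.sat : ClockConstraint → ℝ≥0 → Prop
  | .top, _ => True
  | .eq m, μ => μ = (m : ℝ≥0)
  | .lt m, μ => μ < (m : ℝ≥0)
  | .gt m, μ => (m : ℝ≥0) < μ
  | .le m, μ => μ ≤ (m : ℝ≥0)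
  | .ge m, μ => (m : ℝ≥0) ≤ μ
  | .conj φ₁ φ₂, μ => φ₁.sat μ ∧ φ₂.sat μ

/-- The region `⟦μ⟧` of a clock value: `[μ,μ]` if `μ ∈ ℕ`, and `(⌊μ⌋, ⌊μ⌋+1)` otherwise. -/
noncomputable def region (μ : ℝ≥0) : Set ℝ≥0 :=
  if (⌊μ⌋₊ : ℝ≥0) = μ then {μ} else Set.Ioo (⌊μ⌋₊ : ℝ≥0) ((⌊μ⌋₊ : ℝ≥0) + 1)

/-- The normalization map `g_θ` : `μ ↦ μ` if `μ ∈ ℕ`, `μ ↦ ⌊μ⌋ + θ` otherwise. -/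
noncomputable def gNorm (θ : ℝ≥0) (μ : ℝ≥0) : ℝ≥0 :=
  if (⌊μ⌋₊ : ℝ≥0) = μ then μ else (⌊μ⌋₊ : ℝ≥0) + θ

/-- Normalization of a reset-logical-timed word (normalizing each clock value). -/
noncomputable def normalizeWord {α : Type} (θ : ℝ≥0) (w : List (α × ℝ≥0 × Bool)) :
    List (α × ℝ≥0 × Bool) :=
  w.map fun x => (x.1, gNorm θ x.2.1, x.2.2)

/-- A one-clock timed automaton (OTA) over the alphabet `α`: a finite set `Q` of
locations, an initial location `q0`, accepting locations `F`, and a finite set `Δ` of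
transitions `(q, σ, φ, b, q')`, where `b` tells whether the clock is reset. -/
structure OTA (α : Type) where
  Q : Type
  [finQ : Finite Q]
  q0 : Q
  F : Set Q
  Δ : Set (Q × α × ClockConstraint × Bool × Q)
  finΔ : Δ.Finite

/-- One step of a run: delay `t`, action `σ`, guard `φ`, reset bit `b`, target location `tgt`. -/
structure Step (α Q : Type) where
  t : ℝ≥0
  σ : α
  φ : ClockConstraint
  b : Bool
  tgt : Q

/-- The final location of a run starting at location `q`. -/
def endLoc {α Q : Type} (q : Q) (run : List (Step α Q)) : Q :=
  run.foldl (fun _ s => s.tgt) q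

/-- The final clock valuation of a run starting with clock valuation `ν`. -/
def endVal {α Q : Type} (ν : ℝ≥0) (run : List (Step α Q)) : ℝ≥0 :=
  run.foldl (fun ν s => if s.b then 0 else ν + s.t) ν

/-- The trace (delay-timed word) `(σ₁,t₁)⋯(σₙ,tₙ)` of a run. -/
def traceW {α Q : Type} (run : List (Step α Q)) : List (α × ℝ≥0) :=
  run.map fun s => (s.σ, s.t)

/-- The reset-delay-timed word `(σ₁,t₁,b₁)⋯(σₙ,tₙ,bₙ)` of a run. -/
def resetTraceW {α Q : Type} (run : List (Step α Q)) : List (α × ℝ≥0 × Bool) :=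
  run.map fun s => (s.σ, s.t, s.b)

/-- The sequence of transitions taken by a run (all data of each step except the delay). -/
def transSeq {α Q : Type} (run : List (Step α Q)) : List (α × ClockConstraint × Bool × Q) :=
  run.map fun s => (s.σ, s.φ, s.b, s.tgt)

namespace OTA

variable {α : Type}

/-- `A.IsRunFrom q ν steps` holds iff `steps` is a run of `A` from the state `(q, ν)`:
each step takes a transition of `A` whose guard is satisfied by the current clock value
plus the delay, updating the clock valuation (reset to `0` if the reset bit is set). -/
def IsRunFrom (A : OTA α) : A.Q → ℝ≥0 → List (Step α A.Q) → Prop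
  | _, _, [] => True
  | q, ν, s :: rest =>
    (q, s.σ, s.φ, s.b, s.tgt) ∈ A.Δ ∧ s.φ.sat (ν + s.t) ∧
      A.IsRunFrom s.tgt (if s.b then 0 else ν + s.t) rest

/-- The recognized (delay-)timed language `𝓛(A)`: traces of accepting runs. -/
def L (A : OTA α) : Set (List (α × ℝ≥0)) :=
  {w | ∃ run : List (Step α A.Q),
    A.IsRunFrom A.q0 0 run ∧ endLoc A.q0 run ∈ A.F ∧ traceW run = w}

/-- The recognized reset-delay-timed language `𝓛_r(A)`. -/
def Lr (A : OTA α) : Set (List (α × ℝ≥0 × Bool)) :=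
  {w | ∃ run : List (Step α A.Q),
    A.IsRunFrom A.q0 0 run ∧ endLoc A.q0 run ∈ A.F ∧ resetTraceW run = w}

/-- `A` is deterministic (a DOTA): guards of distinct transitions out of the same
location with the same action are disjoint. -/
def Deterministic (A : OTA α) : Prop :=
  ∀ q σ φ₁ b₁ q₁ φ₂ b₂ q₂, (q, σ, φ₁, b₁, q₁) ∈ A.Δ → (q, σ, φ₂, b₂, q₂) ∈ A.Δ →
    (∃ μ, φ₁.sat μ ∧ φ₂.sat μ) → φ₁ = φ₂ ∧ b₁ = b₂ ∧ q₁ = q₂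

/-- `A` is complete: for every location, action and clock value, some transition is
enabled (together with `Deterministic`, the guards partition `ℝ≥0`). -/
def Complete (A : OTA α) : Prop :=
  ∀ q σ (μ : ℝ≥0), ∃ φ b q', (q, σ, φ, b, q') ∈ A.Δ ∧ φ.sat μ

end OTA

/-- Auxiliary function for `Γ`, accumulating the current logical clock value. -/
def GammaAux {α : Type} : ℝ≥0 → List (α × ℝ≥0 × Bool) → List (α × ℝ≥0 × Bool)
  | _, [] => []
  | ν, (σ, t, b) :: rest => (σ, ν + t, b) :: GammaAux (if b then 0 else ν + t) rest

/-- The map `Γ` from reset-delay-timed words to reset-logical-timed words: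
`μ₁ = t₁`, and `μᵢ = tᵢ` if `b_{i-1} = ⊤`, `μᵢ = μ_{i-1} + tᵢ` otherwise. -/
def Gamma {α : Type} (w : List (α × ℝ≥0 × Bool)) : List (α × ℝ≥0 × Bool) :=
  GammaAux 0 w

/-- Auxiliary function for the inverse of `Γ`, accumulating the previous logical clock
value (or `0` after a reset). -/
noncomputable def GammaInvAux {α : Type} : ℝ≥0 → List (α × ℝ≥0 × Bool) → List (α × ℝ≥0 × Bool)
  | _, [] => []
  | prev, (σ, μ, b) :: rest => (σ, μ - prev, b) :: GammaInvAux (if b then 0 else μ) rest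

/-- The inverse of `Γ`: `t₁ = μ₁`, and for `i ≥ 2`, `tᵢ = μᵢ` if `b_{i-1} = ⊤` and
`tᵢ = μᵢ - μ_{i-1}` otherwise. -/
noncomputable def GammaInv {α : Type} (w : List (α × ℝ≥0 × Bool)) : List (α × ℝ≥0 × Bool) :=
  GammaInvAux 0 w

/-- The set of reset-logical-timed words: words `(σᵢ,μᵢ,bᵢ)_{i=1..n}` satisfying
`μᵢ ≥ μ_{i-1}` whenever `2 ≤ i ≤ n` and `b_{i-1} = ⊥`. -/
def LogicalWords (α : Type) : Set (List (α × ℝ≥0 × Bool)) :=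
  {w | List.Chain' (fun p q => p.2.2 = false → p.2.1 ≤ q.2.1) w}

/-- The interval of the partition function determined by the left base point `a` and
the right endpoint `b` (`none` standing for `∞`). -/
noncomputable def PInterval (a : ℝ≥0) (b : Option ℝ≥0) : Set ℝ≥0 :=
  match b with
  | none => if (⌊a⌋₊ : ℝ≥0) = a then Set.Ici a else Set.Ioi (⌊a⌋₊ : ℝ≥0)
  | some b =>
    if (⌊a⌋₊ : ℝ≥0) = a then
      if (⌊b⌋₊ : ℝ≥0) = b then Set.Ico a b else Set.Icc a (⌊b⌋₊ : ℝ≥0)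
    else
      if (⌊b⌋₊ : ℝ≥0) = b then Set.Ioo (⌊a⌋₊ : ℝ≥0) b
      else Set.Ioc (⌊a⌋₊ : ℝ≥0) (⌊b⌋₊ : ℝ≥0)

theorem gammaAux_injective {α : Type} (ν : ℝ≥0) :
    Function.Injective (GammaAux (α := α) ν) := by
  intro w
  induction w generalizing ν with
  | nil => rintro (_ | ⟨⟨σ, t, b⟩, w⟩) h <;> simp_all [GammaAux]
  | cons x w ih =>
    obtain ⟨σ, t, b⟩ := x
    rintro (_ | ⟨⟨σ', t', b'⟩, w'⟩) h
    · simp [GammaAux] at h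
    · simp only [GammaAux, List.cons.injEq, Prod.mk.injEq, add_right_inj] at h
      obtain ⟨⟨rfl, rfl, rfl⟩, h⟩ := h
      rw [ih _ h]

theorem OTA.L_eq_image_Lr {α : Type} (A : OTA α) :
    A.L = List.map (fun x => (x.1, x.2.1)) '' A.Lr := by
  ext w
  constructor
  · rintro ⟨run, hrun, hend, rfl⟩
    exact ⟨_, ⟨run, hrun, hend, rfl⟩, by simp [traceW, resetTraceW]⟩
  · rintro ⟨_, ⟨run, hrun, hend, rfl⟩, rfl⟩
    exact ⟨run, hrun, hend, by simp [traceW, resetTraceW]⟩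

/-- Theorem 1 of the paper. For any two deterministic one-clock timed
automata `A` and `B`, if `L_r(A) = L_r(B)` then `𝓛(A) = 𝓛(B)`. -/
theorem reset_logical_lang_eq_imp_timed_lang_eq {α : Type} [Finite α]
    (A B : OTA α) (hA : A.Deterministic) (hB : B.Deterministic)
    (h : Gamma '' A.Lr = Gamma '' B.Lr) : A.L = B.L := by
  rw [A.L_eq_image_Lr, B.L_eq_image_Lr, (gammaAux_injective 0).image_injective h]
end

section
/- Normalization preserves runs (Theorem 4 of the paper): let A be a deterministic one-clock timed automaton, let γ_r=(σ1,μ1,b1)...(σn,μn,bn) be a valid reset-logical-timed word of A (i.e. γ_r = Γ(trace_r(ρ)) for some run ρ of A from the initial state), and fix θ∈(0,1). Then the normalized word g(γ_r)=(σ1,μ1',b1)...(σn,μn',bn), where μi'=μi if μi∈ℕ and μi'=⌊μi⌋+θ otherwise, is also a valid reset-logical-timed word of A arising from a run that takes exactly the same sequence of transitions as ρ; in particular γ_r ∈ L_r(A) if and only if g(γ_r) ∈ L_r(A). -/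
open scoped Classical NNReal

theorem gNorm_of_floor_eq (θ : ℝ≥0) {μ : ℝ≥0} (h : (⌊μ⌋₊ : ℝ≥0) = μ) : gNorm θ μ = μ :=
  if_pos h

theorem gNorm_of_floor_ne (θ : ℝ≥0) {μ : ℝ≥0} (h : (⌊μ⌋₊ : ℝ≥0) ≠ μ) :
    gNorm θ μ = ⌊μ⌋₊ + θ :=
  if_neg h

theorem gNorm_zero (θ : ℝ≥0) : gNorm θ 0 = 0 :=
  gNorm_of_floor_eq θ (by simp)

theorem natCast_le_iff_of_mem_Ioo {n : ℕ} {x : ℝ≥0} (hx : x ∈ Set.Ioo (n : ℝ≥0) (n + 1)) (m : ℕ) :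
    (m : ℝ≥0) ≤ x ↔ m ≤ n := by
  constructor
  · intro h
    have : (m : ℝ≥0) < (n + 1 : ℕ) := by push_cast; exact h.trans_lt hx.2
    exact Nat.lt_succ_iff.mp (Nat.cast_lt.mp this)
  · intro h
    exact (Nat.cast_le.mpr h).trans hx.1.le

theorem le_natCast_iff_of_mem_Ioo {n : ℕ} {x : ℝ≥0} (hx : x ∈ Set.Ioo (n : ℝ≥0) (n + 1)) (m : ℕ) :
    x ≤ (m : ℝ≥0) ↔ n < m := by
  constructor
  · intro h
    exact Nat.cast_lt.mp (hx.1.trans_le h)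
  · intro h
    have : ((n + 1 : ℕ) : ℝ≥0) ≤ m := Nat.cast_le.mpr h
    push_cast at this
    exact hx.2.le.trans this

theorem mem_Ioo_floor {μ : ℝ≥0} (h : (⌊μ⌋₊ : ℝ≥0) ≠ μ) :
    μ ∈ Set.Ioo (⌊μ⌋₊ : ℝ≥0) (⌊μ⌋₊ + 1) :=
  ⟨lt_of_le_of_ne (Nat.floor_le zero_le) h, Nat.lt_floor_add_one μ⟩

theorem gNorm_mem_Ioo_floor {θ μ : ℝ≥0} (h0 : 0 < θ) (h1 : θ < 1) (h : (⌊μ⌋₊ : ℝ≥0) ≠ μ) :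
    gNorm θ μ ∈ Set.Ioo (⌊μ⌋₊ : ℝ≥0) (⌊μ⌋₊ + 1) := by
  rw [gNorm_of_floor_ne θ h]
  exact ⟨lt_add_of_pos_right _ h0, by gcongr⟩

theorem natCast_le_gNorm_iff {θ : ℝ≥0} (h0 : 0 < θ) (h1 : θ < 1) (m : ℕ) (μ : ℝ≥0) :
    (m : ℝ≥0) ≤ gNorm θ μ ↔ (m : ℝ≥0) ≤ μ := by
  by_cases h : (⌊μ⌋₊ : ℝ≥0) = μ
  · rw [gNorm_of_floor_eq θ h]
  · rw [natCast_le_iff_of_mem_Ioo (gNorm_mem_Ioo_floor h0 h1 h),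
      natCast_le_iff_of_mem_Ioo (mem_Ioo_floor h)]

theorem gNorm_le_natCast_iff {θ : ℝ≥0} (h0 : 0 < θ) (h1 : θ < 1) (m : ℕ) (μ : ℝ≥0) :
    gNorm θ μ ≤ (m : ℝ≥0) ↔ μ ≤ (m : ℝ≥0) := by
  by_cases h : (⌊μ⌋₊ : ℝ≥0) = μ
  · rw [gNorm_of_floor_eq θ h]
  · rw [le_natCast_iff_of_mem_Ioo (gNorm_mem_Ioo_floor h0 h1 h),
      le_natCast_iff_of_mem_Ioo (mem_Ioo_floor h)]

theorem gNorm_mono {θ : ℝ≥0} (h0 : 0 < θ) (h1 : θ < 1) : Monotone (gNorm θ) := by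
  intro μ ν hμν
  by_cases hμ : (⌊μ⌋₊ : ℝ≥0) = μ
  · rw [gNorm_of_floor_eq θ hμ, ← hμ, natCast_le_gNorm_iff h0 h1, hμ]
    exact hμν
  by_cases hν : (⌊ν⌋₊ : ℝ≥0) = ν
  · rw [gNorm_of_floor_eq θ hν, ← hν, gNorm_le_natCast_iff h0 h1, hν]
    exact hμν
  rw [gNorm_of_floor_ne θ hμ, gNorm_of_floor_ne θ hν]
  gcongr

/-- Normalization does not change which clock constraints are satisfied. -/
theorem ClockConstraint.sat_gNorm_iff {θ : ℝ≥0} (h0 : 0 < θ) (h1 : θ < 1)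
    (φ : ClockConstraint) (μ : ℝ≥0) : φ.sat (gNorm θ μ) ↔ φ.sat μ := by
  induction φ with
  | top => rfl
  | eq m =>
    simp only [sat, le_antisymm_iff, gNorm_le_natCast_iff h0 h1, natCast_le_gNorm_iff h0 h1]
  | lt m => simp only [sat, ← not_le, natCast_le_gNorm_iff h0 h1]
  | gt m => simp only [sat, ← not_le, gNorm_le_natCast_iff h0 h1]
  | le m => exact gNorm_le_natCast_iff h0 h1 m μ
  | ge m => exact natCast_le_gNorm_iff h0 h1 m μ
  | conj φ₁ φ₂ ih₁ ih₂ => exact and_congr ih₁ ih₂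

theorem endLoc_eq_foldl_transSeq {α Q : Type} (q : Q) (run : List (Step α Q)) :
    endLoc q run = (transSeq run).foldl (fun _ x => x.2.2.2) q := by
  simp [endLoc, transSeq, List.foldl_map]

theorem endLoc_congr {α Q : Type} (q : Q) {r s : List (Step α Q)}
    (h : transSeq r = transSeq s) : endLoc q r = endLoc q s := by
  rw [endLoc_eq_foldl_transSeq, endLoc_eq_foldl_transSeq, h]

namespace OTA

variable {α : Type}

/-- A run from `(q, ν)` can be replayed from `(q, gNorm θ ν)` along the same transitions so that
every logical clock value gets normalized. -/
theorem IsRunFrom.exists_normalized {A : OTA α} {θ : ℝ≥0} (h0 : 0 < θ) (h1 : θ < 1)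
    (r : List (Step α A.Q)) {q : A.Q} {ν : ℝ≥0} (hr : A.IsRunFrom q ν r) :
    ∃ r' : List (Step α A.Q), A.IsRunFrom q (gNorm θ ν) r' ∧ transSeq r' = transSeq r ∧
      GammaAux (gNorm θ ν) (resetTraceW r') =
        normalizeWord θ (GammaAux ν (resetTraceW r)) := by
  induction r generalizing q ν with
  | nil => exact ⟨[], trivial, rfl, rfl⟩
  | cons s rest ih =>
    obtain ⟨hΔ, hsat, hrest⟩ := hr
    obtain ⟨r', hrun, htrans, hword⟩ := ih hrest
    have hdelay : gNorm θ ν + (gNorm θ (ν + s.t) - gNorm θ ν) = gNorm θ (ν + s.t) :=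
      add_tsub_cancel_of_le (gNorm_mono h0 h1 le_self_add)
    have hreset : (if s.b then 0 else gNorm θ (ν + s.t)) =
        gNorm θ (if s.b then 0 else ν + s.t) := by
      split_ifs
      · exact (gNorm_zero θ).symm
      · rfl
    refine ⟨{ s with t := gNorm θ (ν + s.t) - gNorm θ ν } :: r', ⟨hΔ, ?_, ?_⟩, ?_, ?_⟩
    · simpa only [hdelay, ClockConstraint.sat_gNorm_iff h0 h1] using hsat
    · simpa only [hdelay, hreset] using hrun
    · exact congrArg (_ :: ·) htrans
    · simp only [resetTraceW, List.map_cons, GammaAux, normalizeWord, hdelay, hreset]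
      exact congrArg (_ :: ·) hword

/-- In a deterministic automaton, a run whose logical word is the normalization of that of
another run takes the same transitions. -/
theorem Deterministic.transSeq_eq {A : OTA α} (hdet : A.Deterministic) {θ : ℝ≥0}
    (h0 : 0 < θ) (h1 : θ < 1) (r s : List (Step α A.Q)) {q : A.Q} {ν ν' : ℝ≥0}
    (hr : A.IsRunFrom q ν r) (hs : A.IsRunFrom q ν' s)
    (hword : GammaAux ν' (resetTraceW s) = normalizeWord θ (GammaAux ν (resetTraceW r))) :
    transSeq s = transSeq r := by
  induction r generalizing q ν ν' s with
  | nil =>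
    cases s with
    | nil => rfl
    | cons y s => simp [resetTraceW, GammaAux, normalizeWord] at hword
  | cons x r ih =>
    cases s with
    | nil => simp [resetTraceW, GammaAux, normalizeWord] at hword
    | cons y s =>
      obtain ⟨tx, σ, φ, b, p⟩ := x
      obtain ⟨ty, σ', φ', b', p'⟩ := y
      obtain ⟨hΔr, hsatr, hr⟩ := hr
      obtain ⟨hΔs, hsats, hs⟩ := hs
      simp only [resetTraceW, List.map_cons, GammaAux, normalizeWord, List.cons.injEq,
        Prod.mk.injEq] at hword
      obtain ⟨⟨rfl, hμ, rfl⟩, hword⟩ := hword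
      dsimp only at hsats hΔs hΔr hsatr hs hr
      rw [hμ, ClockConstraint.sat_gNorm_iff h0 h1] at hsats
      obtain ⟨rfl, -, rfl⟩ := hdet _ _ _ _ _ _ _ _ hΔr hΔs ⟨_, hsatr, hsats⟩
      exact congrArg (_ :: ·) (ih s hr hs hword)

end OTA

/-- Theorem 4 of the paper. Normalization preserves runs: for a DOTA
`A`, a run `r` from the initial state with reset-logical-timed word
`γ_r = Γ(trace_r(r))`, and `θ ∈ (0,1)`, the normalized word `g(γ_r)` is the
reset-logical-timed word of a run taking exactly the same sequence of transitions;
in particular `γ_r ∈ L_r(A) ↔ g(γ_r) ∈ L_r(A)`. -/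
theorem normalization_preserves_runs {α : Type} [Finite α] (A : OTA α)
    (hdet : A.Deterministic) (θ : ℝ≥0) (h0 : 0 < θ) (h1 : θ < 1)
    (r : List (Step α A.Q)) (hr : A.IsRunFrom A.q0 0 r) :
    (∃ r' : List (Step α A.Q), A.IsRunFrom A.q0 0 r' ∧ transSeq r' = transSeq r ∧
        Gamma (resetTraceW r') = normalizeWord θ (Gamma (resetTraceW r))) ∧
    (Gamma (resetTraceW r) ∈ Gamma '' A.Lr ↔
      normalizeWord θ (Gamma (resetTraceW r)) ∈ Gamma '' A.Lr) := by
  have normalized : ∀ r : List (Step α A.Q), A.IsRunFrom A.q0 0 r →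
      ∃ r' : List (Step α A.Q), A.IsRunFrom A.q0 0 r' ∧ transSeq r' = transSeq r ∧
        Gamma (resetTraceW r') = normalizeWord θ (Gamma (resetTraceW r)) := fun r hr => by
    simpa only [gNorm_zero, Gamma] using hr.exists_normalized h0 h1
  refine ⟨normalized r hr, ?_, ?_⟩
  · rintro ⟨_, ⟨s, hs, hF, rfl⟩, hword⟩
    obtain ⟨s', hs', htrans, hword'⟩ := normalized s hs
    exact ⟨_, ⟨s', hs', endLoc_congr A.q0 htrans ▸ hF, rfl⟩, hword'.trans (by rw [hword])⟩
  · rintro ⟨_, ⟨s, hs, hF, rfl⟩, hword⟩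
    have htrans := hdet.transSeq_eq h0 h1 r s hr hs hword
    exact ⟨_, ⟨r, hr, endLoc_congr A.q0 htrans ▸ hF, rfl⟩, rfl⟩
end

section
/- The partition function is well defined: given a list 0=μ0 < μ1 < ... < μn of elements of ℝ≥0 such that any two distinct non-integer entries have distinct integer parts, and setting μ_{n+1}=∞, the intervals I_0,...,I_n defined by I_i = [μi, μ_{i+1}) if μi∈ℕ and μ_{i+1}∈ℕ; I_i = (⌊μi⌋, μ_{i+1}) if μi∉ℕ and μ_{i+1}∈ℕ; I_i = [μi, ⌊μ_{i+1}⌋] if μi∈ℕ and μ_{i+1}∉ℕ; and I_i = (⌊μi⌋, ⌊μ_{i+1}⌋] if μi∉ℕ and μ_{i+1}∉ℕ (where for μ_{n+1}=∞ the right endpoints are interpreted as ∞, giving half-open-to-infinity intervals), are pairwise disjoint, their union is all of ℝ≥0, and μi ∈ I_i for every 0 ≤ i ≤ n. -/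
open scoped Classical NNReal

/-- `x` lies to the right of the left endpoint of an interval with base point `a`. -/
def LeftOf (a x : ℝ≥0) : Prop :=
  if (⌊a⌋₊ : ℝ≥0) = a then a ≤ x else (⌊a⌋₊ : ℝ≥0) < x

theorem mem_PInterval_none {a x : ℝ≥0} : x ∈ PInterval a none ↔ LeftOf a x := by
  unfold PInterval LeftOf
  split_ifs <;> simp

theorem mem_PInterval_some {a b x : ℝ≥0} :
    x ∈ PInterval a (some b) ↔ LeftOf a x ∧ ¬ LeftOf b x := by
  unfold PInterval LeftOf
  dsimp only
  split_ifs <;> simp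

theorem LeftOf.refl (a : ℝ≥0) : LeftOf a a := by
  unfold LeftOf
  split_ifs with h
  · exact le_rfl
  · exact lt_of_le_of_ne (Nat.floor_le a.2) h

theorem LeftOf.anti {a b x : ℝ≥0} (hab : a ≤ b) (h : LeftOf b x) : LeftOf a x := by
  have hf : (⌊a⌋₊ : ℝ≥0) ≤ ⌊b⌋₊ := Nat.cast_le.2 (Nat.floor_mono hab)
  have ha : (⌊a⌋₊ : ℝ≥0) ≤ a := Nat.floor_le a.2
  unfold LeftOf at *
  split_ifs at * with h₁ h₂ h₂
  · exact hab.trans h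
  · exact h₁ ▸ hf.trans h.le
  · exact (lt_of_le_of_ne ha h₁).trans_le (hab.trans h)
  · exact hf.trans_lt h

theorem not_leftOf_of_lt {a b : ℝ≥0} (hab : a < b)
    (h : (⌊a⌋₊ : ℝ≥0) ≠ a → (⌊b⌋₊ : ℝ≥0) ≠ b → ⌊a⌋₊ ≠ ⌊b⌋₊) : ¬ LeftOf b a := by
  have hf : ⌊a⌋₊ ≤ ⌊b⌋₊ := Nat.floor_mono hab.le
  unfold LeftOf
  split_ifs with hb
  · exact hab.not_ge
  · rw [not_lt]
    by_cases ha : (⌊a⌋₊ : ℝ≥0) = a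
    · exact ha ▸ Nat.cast_le.2 hf
    · have hlt : ⌊a⌋₊ + 1 ≤ ⌊b⌋₊ := lt_of_le_of_ne hf (h ha hb)
      calc a ≤ ((⌊a⌋₊ + 1 : ℕ) : ℝ≥0) := by exact_mod_cast (Nat.lt_floor_add_one a).le
        _ ≤ ⌊b⌋₊ := Nat.cast_le.2 hlt

/-- The partition function is well defined: given
`0 = μ₀ < μ₁ < ⋯ < μₙ` in `ℝ≥0` such that distinct non-integer entries have distinct
integer parts, the intervals `I₀, …, Iₙ` (defined case-wise from consecutive points,
with `μ_{n+1} = ∞`) are pairwise disjoint, cover `ℝ≥0`, and `μᵢ ∈ Iᵢ` for all `i`. -/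
theorem partition_function_wd (n : ℕ) (μ : Fin (n + 1) → ℝ≥0)
    (h0 : μ 0 = 0) (hmono : StrictMono μ)
    (hfloor : ∀ i j : Fin (n + 1), i ≠ j →
      (⌊μ i⌋₊ : ℝ≥0) ≠ μ i → (⌊μ j⌋₊ : ℝ≥0) ≠ μ j → ⌊μ i⌋₊ ≠ ⌊μ j⌋₊)
    (I : Fin (n + 1) → Set ℝ≥0)
    (hI : ∀ i : Fin (n + 1), I i =
      if h : (i : ℕ) < n then PInterval (μ i) (some (μ ⟨(i : ℕ) + 1, by omega⟩))
      else PInterval (μ i) none) :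
    (Pairwise fun i j => Disjoint (I i) (I j)) ∧ (⋃ i, I i) = Set.univ ∧
      ∀ i, μ i ∈ I i := by
  have hmem : ∀ i x, x ∈ I i ↔ LeftOf (μ i) x ∧ ∀ j, i < j → ¬ LeftOf (μ j) x := by
    intro i x
    rw [hI]
    split_ifs with h
    · rw [mem_PInterval_some]
      refine and_congr_right fun _ => ⟨fun hx j hij hj => hx (hj.anti ?_), fun hx => hx _ ?_⟩
      · exact hmono.monotone (Fin.mk_le_of_le_val (Nat.succ_le_of_lt hij))
      · exact Fin.lt_def.2 (Nat.lt_succ_self _)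
    · rw [mem_PInterval_none]
      refine (and_iff_left fun j hij => ?_).symm
      have := Fin.lt_def.1 hij
      omega
  refine ⟨fun i j hij => ?_, Set.eq_univ_of_forall fun x => ?_, fun i => ?_⟩
  · refine Set.disjoint_left.2 ?_
    intro x hi hj
    rw [hmem] at hi hj
    rcases hij.lt_or_gt with h | h
    · exact hi.2 j h hj.1
    · exact hj.2 i h hi.1
  · have hzero : LeftOf (μ 0) x := (LeftOf.refl x).anti (h0 ▸ zero_le)
    obtain ⟨i, hi, hmax⟩ := (Set.toFinite {i | LeftOf (μ i) x}).exists_maximal ⟨0, hzero⟩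
    exact Set.mem_iUnion.2 ⟨i, (hmem i x).2 ⟨hi, fun j hij hj => (hmax hj hij.le).not_gt hij⟩⟩
  · exact (hmem i _).2 ⟨LeftOf.refl _, fun j hij =>
      not_leftOf_of_lt (hmono hij) (hfloor i j hij.ne)⟩
end

section
/- In a deterministic one-clock timed automaton, the logical-timed word determines the run: if A is a DOTA and ρ, ρ' are runs of A from the initial state such that the projections onto the first two components of Γ(trace_r(ρ)) and Γ(trace_r(ρ')) are equal (i.e. they have the same logical-timed word (σi,μi)_{i=1..n}), then ρ = ρ'; in particular the reset bits b1,...,bn are uniquely determined by the logical-timed word. -/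
open scoped Classical NNReal

theorem OTA.IsRunFrom.eq_of_logical_word_eq {α : Type} {A : OTA α} (hdet : A.Deterministic)
    {r r' : List (Step α A.Q)} {q : A.Q} {ν : ℝ≥0}
    (hr : A.IsRunFrom q ν r) (hr' : A.IsRunFrom q ν r')
    (h : (GammaAux ν (resetTraceW r)).map (fun x => (x.1, x.2.1)) =
         (GammaAux ν (resetTraceW r')).map (fun x => (x.1, x.2.1))) :
    r = r' := by
  induction r generalizing r' q ν with
  | nil =>
    cases r' with
    | nil => rfl
    | cons s' l' => simp [resetTraceW, GammaAux] at h
  | cons s l ih =>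
    cases r' with
    | nil => simp [resetTraceW, GammaAux] at h
    | cons s' l' =>
      obtain ⟨t, σ, φ, b, p⟩ := s
      obtain ⟨t', σ', φ', b', p'⟩ := s'
      simp only [resetTraceW, List.map_cons, GammaAux, List.cons.injEq, Prod.mk.injEq,
        add_right_inj] at h
      obtain ⟨⟨rfl, rfl⟩, htail⟩ := h
      obtain ⟨hΔ, hsat, hrun⟩ := hr
      obtain ⟨hΔ', hsat', hrun'⟩ := hr'
      obtain ⟨rfl, rfl, rfl⟩ := hdet _ _ _ _ _ _ _ _ hΔ hΔ' ⟨_, hsat, hsat'⟩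
      rw [ih hrun hrun' htail]

/-- In a DOTA, the logical-timed word determines the run: if two runs
from the initial state have the same logical-timed word (the projection of their
reset-logical-timed words onto the first two components), they are identical; in
particular the reset bits are determined by the logical-timed word. -/
theorem dota_run_unique_of_logical_word_eq {α : Type} [Finite α] (A : OTA α)
    (hdet : A.Deterministic) (r r' : List (Step α A.Q))
    (hr : A.IsRunFrom A.q0 0 r) (hr' : A.IsRunFrom A.q0 0 r')
    (h : (Gamma (resetTraceW r)).map (fun x => (x.1, x.2.1)) =
         (Gamma (resetTraceW r')).map (fun x => (x.1, x.2.1))) :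
    r = r' := by
  exact hr.eq_of_logical_word_eq hdet hr' h
end
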